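/- Δ has weak Property E if and only if for every 0 ≤ k ≤ d one has h_k(Δ) − h_{d−k}(Δ) = (−1)^k (d choose k) · ( (1 + (−1)^{d−1}) − χ̃(Δ) ), i.e. the h-vector of Δ satisfies the general Dehn–Sommerville equations. -/

import Mathlib

/-- `f_{i-1}(Δ)`: the number of faces of `Δ` of cardinality `i`. -/
def faceCount (n : ℕ) (Δ : Finset (Finset (Fin n))) (i : ℕ) : ℕ :=
  (Δ.filter fun σ => σ.card = i).card

/-- The `e`-vector: `e_k(Δ) = ∑_{i=k}^{d} (−1)^{i−k} (i choose k) f_{i−1}(Δ)`. -/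
def eVec (n d : ℕ) (Δ : Finset (Finset (Fin n))) (k : ℕ) : ℤ :=
  ∑ i ∈ Finset.Icc k d, (-1) ^ (i - k) * (i.choose k : ℤ) * (faceCount n Δ i : ℤ)

/-- The `h`-vector: `h_k(Δ) = ∑_{i=0}^{k} (−1)^{k−i} (d−i choose k−i) f_{i−1}(Δ)`. -/
def hVec (n d : ℕ) (Δ : Finset (Finset (Fin n))) (k : ℕ) : ℤ :=
  ∑ i ∈ Finset.range (k + 1), (-1) ^ (k - i) * ((d - i).choose (k - i) : ℤ) * (faceCount n Δ i : ℤ)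

/-- The reduced Euler characteristic `χ̃(Δ) = ∑_{i=0}^{d−1} (−1)^i f_i(Δ)`
(here `f_i` counts faces of cardinality `i+1`). -/
def redEuler (n d : ℕ) (Δ : Finset (Finset (Fin n))) : ℤ :=
  ∑ i ∈ Finset.range d, (-1) ^ i * (faceCount n Δ (i + 1) : ℤ)

open Finset in
/-- Homogeneous form of the transformation from the `f`-vector to the `h`-vector. -/
theorem sum_hVec_mul_pow {R : Type*} [CommRing R] (n d : ℕ) (Δ : Finset (Finset (Fin n)))
    (a b : R) :
    ∑ k ∈ range (d + 1), (hVec n d Δ k : R) * a ^ k * b ^ (d - k) =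
      ∑ i ∈ range (d + 1), (faceCount n Δ i : R) * a ^ i * (b - a) ^ (d - i) := by
  simp only [hVec, Int.cast_sum, sum_mul]
  have expand : ∀ i ∈ range (d + 1), (faceCount n Δ i : R) * a ^ i * (b - a) ^ (d - i) =
      ∑ j ∈ range (d - i + 1), (faceCount n Δ i : R) * a ^ i *
        ((-a) ^ j * b ^ (d - i - j) * ((d - i).choose j : R)) := by
    intro i _
    rw [← mul_sum, ← add_pow, neg_add_eq_sub]
  rw [sum_congr rfl expand, sum_sigma', sum_sigma']
  refine sum_bij' (fun x _ => ⟨x.2, x.1 - x.2⟩) (fun x _ => ⟨x.1 + x.2, x.1⟩) ?_ ?_ ?_ ?_ ?_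
  · rintro ⟨k, i⟩ h; simp only [mem_sigma, mem_range] at h ⊢; omega
  · rintro ⟨k, i⟩ h; simp only [mem_sigma, mem_range] at h ⊢; omega
  · rintro ⟨k, i⟩ h; simp only [mem_sigma, mem_range] at h
    simp only [Sigma.mk.injEq, heq_eq_eq, and_true]; omega
  · rintro ⟨k, i⟩ h; simp
  · rintro ⟨k, i⟩ h
    simp only [mem_sigma, mem_range] at h
    obtain ⟨j, rfl⟩ := Nat.exists_eq_add_of_le (Nat.lt_succ_iff.mp h.2)
    simp only [Nat.add_sub_cancel_left, Nat.sub_sub]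
    push_cast
    rw [neg_pow a, pow_add a]
    ring

open Finset in
theorem sum_eVec_mul_pow {R : Type*} [CommRing R] (n d : ℕ) (Δ : Finset (Finset (Fin n)))
    (y : R) :
    ∑ k ∈ range (d + 1), (eVec n d Δ k : R) * y ^ k =
      ∑ i ∈ range (d + 1), (faceCount n Δ i : R) * (y - 1) ^ i := by
  have expand : ∀ i ∈ range (d + 1), (faceCount n Δ i : R) * (y - 1) ^ i =
      ∑ k ∈ range (i + 1), (faceCount n Δ i : R) *
        (y ^ k * (-1) ^ (i - k) * (i.choose k : R)) := by
    intro i _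
    rw [← mul_sum, ← add_pow, sub_eq_add_neg]
  rw [sum_congr rfl expand]
  simp only [eVec, Int.cast_sum, sum_mul]
  rw [sum_comm' (t' := range (d + 1)) (s' := fun i => range (i + 1))]
  · refine sum_congr rfl fun i _ => sum_congr rfl fun k _ => ?_
    push_cast
    ring
  · intro k i
    simp only [mem_range, mem_Icc]
    omega

open Finset Polynomial in
/-- An integer polynomial function is determined by its values at the rationals other than `1`. -/
theorem coeff_eq_of_sum_mul_pow_eq {d : ℕ} {a b : ℕ → ℤ}
    (h : ∀ t : ℚ, t ≠ 1 →
      ∑ k ∈ range (d + 1), (a k : ℚ) * t ^ k = ∑ k ∈ range (d + 1), (b k : ℚ) * t ^ k)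
    {k : ℕ} (hk : k ≤ d) : a k = b k := by
  have key : (∑ k ∈ range (d + 1), C (a k : ℚ) * X ^ k) =
      ∑ k ∈ range (d + 1), C (b k : ℚ) * X ^ k := by
    refine eq_of_infinite_eval_eq _ _ ((Set.finite_singleton (1 : ℚ)).infinite_compl.mono ?_)
    intro t ht
    simpa [eval_finsetSum] using h t ht
  have := congrArg (fun p => coeff p k) key
  simpa [coeff_X_pow, hk, Nat.lt_succ_iff] using this

open Finset in
theorem faceCount_zero {n : ℕ} {Δ : Finset (Finset (Fin n))} (hempty : ∅ ∈ Δ) :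
    faceCount n Δ 0 = 1 := by
  rw [faceCount, card_eq_one]
  refine ⟨∅, ?_⟩
  ext σ
  simp only [mem_filter, card_eq_zero, mem_singleton]
  exact ⟨fun h => h.2, fun h => ⟨h ▸ hempty, h⟩⟩

open Finset in
theorem sum_faceCount_mul_neg_one_pow {R : Type*} [CommRing R] {n : ℕ} (d : ℕ)
    {Δ : Finset (Finset (Fin n))} (hempty : ∅ ∈ Δ) :
    ∑ i ∈ range (d + 1), (faceCount n Δ i : R) * (-1) ^ i = 1 - (redEuler n d Δ : R) := by
  rw [sum_range_succ', faceCount_zero hempty, redEuler]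
  push_cast
  rw [sub_eq_neg_add, ← sum_neg_distrib]
  simp only [pow_zero, mul_one]
  congr 1
  exact sum_congr rfl fun i _ => by ring

open Finset in
/-- The general Dehn–Sommerville equations as a functional equation of the `f`-polynomial. -/
theorem hVec_sub_hVec_eq_iff (n d : ℕ) (Δ : Finset (Finset (Fin n))) (c : ℤ) :
    (∀ k ≤ d, hVec n d Δ k - hVec n d Δ (d - k) = (-1) ^ k * (d.choose k : ℤ) * c) ↔
    ∀ y : ℚ, y ≠ 1 →
      ∑ i ∈ range (d + 1), (faceCount n Δ i : ℚ) * (-y) ^ i -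
        (-1) ^ d * ∑ i ∈ range (d + 1), (faceCount n Δ i : ℚ) * (y - 1) ^ i = c := by
  have left (t : ℚ) : ∑ k ∈ range (d + 1), ((hVec n d Δ k - hVec n d Δ (d - k) : ℤ) : ℚ) * t ^ k =
      ∑ i ∈ range (d + 1), (faceCount n Δ i : ℚ) * t ^ i * (1 - t) ^ (d - i) -
        ∑ i ∈ range (d + 1), (faceCount n Δ i : ℚ) * (t - 1) ^ (d - i) := by
    have h₁ := sum_hVec_mul_pow n d Δ t 1
    have h₂ := sum_hVec_mul_pow n d Δ 1 t
    rw [← sum_range_reflect] at h₂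
    simp only [one_pow, mul_one] at h₁ h₂
    rw [← h₁, ← h₂, ← sum_sub_distrib]
    refine sum_congr rfl fun k hk => ?_
    have hk' : k ≤ d := Nat.lt_succ_iff.mp (mem_range.mp hk)
    rw [show d + 1 - 1 - k = d - k by omega, Nat.sub_sub_self hk']
    push_cast
    ring
  have right (t : ℚ) : ∑ k ∈ range (d + 1), (((-1) ^ k * (d.choose k : ℤ) * c : ℤ) : ℚ) * t ^ k =
      c * (1 - t) ^ d := by
    rw [sub_eq_neg_add, add_pow, mul_sum]
    refine sum_congr rfl fun k _ => ?_
    rw [neg_pow]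
    push_cast
    ring
  have factor {t y : ℚ} (h : (1 - t) * (1 - y) = 1) :
      ∑ i ∈ range (d + 1), (faceCount n Δ i : ℚ) * t ^ i * (1 - t) ^ (d - i) -
        ∑ i ∈ range (d + 1), (faceCount n Δ i : ℚ) * (t - 1) ^ (d - i) =
      (1 - t) ^ d * (∑ i ∈ range (d + 1), (faceCount n Δ i : ℚ) * (-y) ^ i -
        (-1) ^ d * ∑ i ∈ range (d + 1), (faceCount n Δ i : ℚ) * (y - 1) ^ i) := by
    rw [mul_sub, ← mul_assoc, ← mul_pow, mul_sum, mul_sum]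
    congr 1 <;> refine sum_congr rfl fun i hi => ?_
    all_goals
      obtain ⟨j, rfl⟩ := Nat.exists_eq_add_of_le (Nat.lt_succ_iff.mp (mem_range.mp hi))
      rw [Nat.add_sub_cancel_left]
    · rw [show t = (1 - t) * (-y) by linear_combination -h, mul_pow,
        ← show t = (1 - t) * (-y) by linear_combination -h]
      ring
    · rw [show (1 - t) * -1 = t - 1 by ring, pow_add,
        show ((t - 1) ^ i * (t - 1) ^ j) * ((faceCount n Δ i : ℚ) * (y - 1) ^ i) =
          (faceCount n Δ i : ℚ) * ((t - 1) * (y - 1)) ^ i * (t - 1) ^ j by rw [mul_pow]; ring,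
        show (t - 1) * (y - 1) = 1 by linear_combination h]
      ring
  have partner {y : ℚ} (hy : y ≠ 1) : ∃ t : ℚ, t ≠ 1 ∧ (1 - t) * (1 - y) = 1 := by
    have hy' : 1 - y ≠ 0 := sub_ne_zero.mpr hy.symm
    refine ⟨1 - (1 - y)⁻¹, by simpa using hy', ?_⟩
    rw [sub_sub_cancel, inv_mul_cancel₀ hy']
  constructor
  · intro h y hy
    obtain ⟨t, ht, hty⟩ := partner hy
    have ht' : (1 - t) ^ d ≠ 0 := pow_ne_zero _ (sub_ne_zero.mpr ht.symm)
    refine mul_left_cancel₀ ht' ?_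
    rw [← factor hty, ← left, mul_comm _ (c : ℚ), ← right]
    exact sum_congr rfl fun k hk => by rw [h k (Nat.lt_succ_iff.mp (mem_range.mp hk))]
  · intro h k hk
    refine coeff_eq_of_sum_mul_pow_eq (a := fun k => hVec n d Δ k - hVec n d Δ (d - k))
      (b := fun k => (-1) ^ k * (d.choose k : ℤ) * c) (fun t ht => ?_) hk
    obtain ⟨y, hy, hty⟩ := partner ht
    rw [mul_comm] at hty
    rw [left, right, factor hty, h y hy, mul_comm]

theorem weak_propertyE_iff_general_dehn_sommerville
    (n d : ℕ) (Δ : Finset (Finset (Fin n)))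
    (hempty : ∅ ∈ Δ)
    (hdown : ∀ σ ∈ Δ, ∀ τ ⊆ σ, τ ∈ Δ)
    (hd : 1 ≤ d)
    (hdim : ∀ σ ∈ Δ, σ.card ≤ d)
    (hmax : ∃ σ ∈ Δ, σ.card = d) :
    (∀ k, 1 ≤ k → k ≤ d → eVec n d Δ k = (-1) ^ (d - k) * (faceCount n Δ k : ℤ)) ↔
    (∀ k ≤ d, hVec n d Δ k - hVec n d Δ (d - k) =
        (-1) ^ k * (d.choose k : ℤ) * ((1 + (-1) ^ (d - 1)) - redEuler n d Δ)) := by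
  have alternating := sum_faceCount_mul_neg_one_pow (R := ℚ) d hempty
  have sign : ((-1 : ℚ) ^ d) * (-1) ^ d = 1 := by rw [← mul_pow]; norm_num
  have sign_pred : (-1 : ℤ) ^ (d - 1) = -(-1) ^ d := by
    obtain ⟨m, rfl⟩ := Nat.exists_eq_add_of_le' hd
    rw [Nat.add_sub_cancel, pow_succ]
    ring
  have sign_sub {k : ℕ} (hk : k ≤ d) : (-1 : ℚ) ^ (d - k) = (-1) ^ d * (-1) ^ k := by
    obtain ⟨m, rfl⟩ := Nat.exists_eq_add_of_le hk
    rw [Nat.add_sub_cancel_left, pow_add, mul_right_comm, ← mul_pow]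
    norm_num
  have reflected (y : ℚ) :
      ∑ k ∈ Finset.range (d + 1), (((-1) ^ (d - k) * (faceCount n Δ k : ℤ) : ℤ) : ℚ) * y ^ k =
        (-1) ^ d * ∑ i ∈ Finset.range (d + 1), (faceCount n Δ i : ℚ) * (-y) ^ i := by
    rw [Finset.mul_sum]
    refine Finset.sum_congr rfl fun k hk => ?_
    push_cast
    rw [sign_sub (Nat.lt_succ_iff.mp (Finset.mem_range.mp hk)), neg_pow y]
    ring
  rw [hVec_sub_hVec_eq_iff, sign_pred]
  push_cast
  constructor
  · intro h
    have diff (y : ℚ) : ∑ i ∈ Finset.range (d + 1), (faceCount n Δ i : ℚ) * (y - 1) ^ i -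
        (-1) ^ d * ∑ i ∈ Finset.range (d + 1), (faceCount n Δ i : ℚ) * (-y) ^ i =
        eVec n d Δ 0 - (-1) ^ d * faceCount n Δ 0 := by
      rw [← sum_eVec_mul_pow, ← reflected, Finset.sum_range_succ', Finset.sum_range_succ',
        Finset.sum_congr rfl fun k hk => by
          rw [h (k + 1) (by omega) (by have := Finset.mem_range.mp hk; omega)]]
      push_cast
      simp
    have at_one := diff 1
    have constant : ∑ i ∈ Finset.range (d + 1), (faceCount n Δ i : ℚ) * 0 ^ i = 1 := by
      rw [Finset.sum_range_succ', faceCount_zero hempty]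
      simp
    rw [sub_self, alternating, constant] at at_one
    intro y _
    linear_combination (-(-1) ^ d) * diff y + (-1) ^ d * at_one +
      (1 - (redEuler n d Δ : ℚ) -
        ∑ i ∈ Finset.range (d + 1), (faceCount n Δ i : ℚ) * (-y) ^ i) * sign
  · intro h k hk hkd
    have shifted : ∀ y : ℚ, y ≠ 1 →
        ∑ k ∈ Finset.range (d + 1), (eVec n d Δ k : ℚ) * y ^ k =
          ∑ k ∈ Finset.range (d + 1), (((-1) ^ (d - k) * (faceCount n Δ k : ℤ) +
            if k = 0 then -(-1) ^ d * (1 + -(-1) ^ d - redEuler n d Δ) else 0 : ℤ) : ℚ) * y ^ k := by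
      intro y hy
      simp only [Int.cast_add, add_mul, Finset.sum_add_distrib]
      rw [reflected, sum_eVec_mul_pow, Finset.sum_range_succ' (fun k => ((ite _ _ _ : ℤ) : ℚ) * y ^ k)]
      simp only [Nat.succ_ne_zero, if_true, if_false, Int.cast_zero, zero_mul, Finset.sum_const_zero]
      push_cast
      linear_combination (-(-1) ^ d) * h y hy -
        (∑ i ∈ Finset.range (d + 1), (faceCount n Δ i : ℚ) * (y - 1) ^ i) * sign
    have := coeff_eq_of_sum_mul_pow_eq (a := eVec n d Δ) shifted hkd
    simpa [Nat.one_le_iff_ne_zero.mp hk] using this
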